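/- Assume ν-almost surely |F(p)| ≤ K and O ⊆ F(p), assume Regular Facts (for all y, y' ∈ U, ν({p : y ∈ F(p)}) = ν({p : y' ∈ F(p)})), and suppose U is nonempty. Let Π be a measurable assignment p ↦ Π(p) of a partition of Ω to each distribution p. Then ν({p : g(H(p)) ≥ p(U)/(K+1)² − ‖g − p^{Π(p)}‖_TV/(K+1)}) ≥ 1 − K/|U|. (Missing-mass lower bound from the high-confidence bound.) -/

import Mathlib

open MeasureTheory

/-- Total variation distance on a finite type: `max_{S ⊆ Ω} |g(S) − h(S)|`. -/
noncomputable def tvDist {Ω : Type*} [Fintype Ω] [DecidableEq Ω] (g h : Ω → ℝ) : ℝ :=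
  Finset.univ.sup' ⟨∅, Finset.mem_univ ∅⟩
    (fun S : Finset Ω => |∑ y ∈ S, g y - ∑ y ∈ S, h y|)

lemma aux_coarse {Ω : Type*} [Fintype Ω] [DecidableEq Ω] (O : Finset Ω) (K : ℕ)
    (hOK : O.card ≤ K) (p : Ω → ℝ) (hp : ∀ y, 0 ≤ p y) (B : Ω → Finset Ω)
    (hmem : ∀ y, y ∈ B y) (hcell : ∀ y z, z ∈ B y → B z = B y) :
    (∑ y ∈ Oᶜ, p y) / ((K : ℝ) + 1) ≤ ∑ y ∈ Oᶜ, (∑ z ∈ B y, p z) / (B y).card := by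
  have h1 : ∀ y ∈ (Oᶜ : Finset Ω), ∑ z ∈ Oᶜ, (if y ∈ B z then p z / (B z).card else 0)
      ≤ (∑ z ∈ B y, p z) / (B y).card := by
    intro y _
    rw [Finset.sum_div, ← Finset.sum_filter]
    have : ∀ z ∈ (Oᶜ : Finset Ω).filter (fun z => y ∈ B z), p z / ((B z).card : ℝ) = p z / (B y).card := by
      intro z hz
      rw [hcell z y (Finset.mem_filter.1 hz).2]
    rw [Finset.sum_congr rfl this]
    apply Finset.sum_le_sum_of_subset_of_nonneg
    · intro z hz
      have := hcell z y (Finset.mem_filter.1 hz).2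
      rw [this]; exact hmem z
    · intro z _ _
      exact div_nonneg (hp z) (Nat.cast_nonneg _)
  refine le_trans ?_ (Finset.sum_le_sum h1)
  rw [Finset.sum_comm, Finset.sum_div]
  apply Finset.sum_le_sum
  intro z hz
  rw [← Finset.sum_filter, Finset.sum_const, nsmul_eq_mul]
  set C := (Oᶜ : Finset Ω).filter (fun y => y ∈ B z) with hC
  have hC1 : 1 ≤ C.card := Finset.card_pos.2 ⟨z, Finset.mem_filter.2 ⟨hz, hmem z⟩⟩
  have hsub : B z ⊆ C ∪ O := by
    intro y hy
    by_cases h : y ∈ O <;> simp [hC, h, hy]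
  have hB : (B z).card ≤ C.card + K :=
    (Finset.card_le_card hsub).trans ((Finset.card_union_le _ _).trans (by omega))
  have hB0 : 0 < (B z).card := Finset.card_pos.2 ⟨z, hmem z⟩
  have hB2 : (B z).card ≤ C.card * (K + 1) := by nlinarith
  have hB2' : ((B z).card : ℝ) ≤ C.card * ((K : ℝ) + 1) := by exact_mod_cast hB2
  have hB0' : (0 : ℝ) < (B z).card := by exact_mod_cast hB0
  rw [← mul_div_assoc, div_le_div_iff₀ (by positivity) hB0']
  nlinarith [mul_le_mul_of_nonneg_left hB2' (hp z)]

lemma aux_det {Ω : Type*} [Fintype Ω] [DecidableEq Ω] (O : Finset Ω) (K : ℕ)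
    (p : Ω → ℝ) (hp : ∀ y, 0 ≤ p y) (B : Ω → Finset Ω)
    (hmem : ∀ y, y ∈ B y) (hcell : ∀ y z, z ∈ B y → B z = B y)
    (hF : (Finset.univ.filter fun y => 0 < p y).card ≤ K) (hO : ∀ y ∈ O, 0 < p y)
    (g : Ω → ℝ) (hg0 : ∀ y, 0 ≤ g y) (s : Ω)
    (hmax : ∀ y ∈ (Oᶜ : Finset Ω), g y ≤ g s) (hs : ¬ 0 < p s) :
    (∑ y ∈ Oᶜ, p y) / ((K : ℝ) + 1) ^ 2
          - tvDist g (fun y => (∑ z ∈ B y, p z) / (B y).card) / ((K : ℝ) + 1)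
        ≤ ∑ y ∈ (Finset.univ.filter fun y => 0 < p y)ᶜ, g y := by
  set F := Finset.univ.filter fun y => 0 < p y with hFdef
  have hOF : O ⊆ F := fun y hy => by simp [hFdef, hO y hy]
  have h1 := aux_coarse O K ((Finset.card_le_card hOF).trans hF) p hp B hmem hcell
  have h2 : |∑ y ∈ Oᶜ, g y - ∑ y ∈ Oᶜ, (∑ z ∈ B y, p z) / ((B y).card : ℝ)|
      ≤ tvDist g (fun y => (∑ z ∈ B y, p z) / (B y).card) :=
    Finset.le_sup' (fun S : Finset Ω => |∑ y ∈ S, g y - ∑ y ∈ S, (∑ z ∈ B y, p z) / ((B y).card : ℝ)|)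
      (Finset.mem_univ (Oᶜ : Finset Ω))
  have h2' := neg_le_of_abs_le h2
  have h3 : g s ≤ ∑ y ∈ Fᶜ, g y :=
    Finset.single_le_sum (fun y _ => hg0 y) (by simpa [hFdef] using hs)
  have h4 : ∑ y ∈ Oᶜ, g y ≤ ∑ y ∈ Oᶜ ∩ F, g y + ∑ y ∈ Fᶜ, g y := by
    rw [← Finset.sum_union]
    · apply Finset.sum_le_sum_of_subset_of_nonneg
      · intro y hy
        by_cases h : y ∈ F <;> simp_all
      · intro y _ _; exact hg0 y
    · rw [Finset.disjoint_left]
      intro y hy; simp at hy ⊢; exact hy.2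
  have h5 : ∑ y ∈ Oᶜ ∩ F, g y ≤ K * g s := by
    have := Finset.sum_le_card_nsmul (Oᶜ ∩ F) g (g s)
      (fun y hy => hmax y (Finset.mem_inter.1 hy).1)
    rw [nsmul_eq_mul] at this
    refine this.trans (mul_le_mul_of_nonneg_right ?_ (hg0 s))
    exact_mod_cast (Finset.card_le_card Finset.inter_subset_right).trans hF
  have hK0 : (0 : ℝ) ≤ K := Nat.cast_nonneg _
  have h6 := mul_le_mul_of_nonneg_left h3 hK0
  have hK1 : (0 : ℝ) < (K : ℝ) + 1 := by positivity
  rw [pow_two, ← div_div, ← sub_div, div_le_iff₀ hK1]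
  linarith

/-- **Missing-mass lower bound from the high-confidence bound.**
`ν` is a Borel probability measure on the simplex `Δ(Ω)` of probability
distributions on the finite nonempty set `Ω`; for `p ∈ Δ(Ω)`,
`F(p) := {y : p(y) > 0}` and `H(p) := Ω \ F(p)`.  Assume ν-a.s. `|F(p)| ≤ K`
and `O ⊆ F(p)`, Regular Facts, and `U := Oᶜ` nonempty.  `Π` is a measurable
assignment of a partition (given by its cell map) to each `p`.  Then:
`ν({p : g(H(p)) ≥ p(U)/(K+1)² − ‖g − p^{Π(p)}‖_TV/(K+1)}) ≥ 1 − K/|U|`. -/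
theorem missing_mass_high_confidence_bound
    {Ω : Type*} [Fintype Ω] [DecidableEq Ω] [Nonempty Ω]
    [MeasurableSpace (Finset Ω)] [MeasurableSingletonClass (Finset Ω)]
    (O : Finset Ω) (hU : (Oᶜ : Finset Ω).Nonempty)
    (ν : Measure {p : Ω → ℝ // (∀ y, 0 ≤ p y) ∧ ∑ y, p y = 1})
    [IsProbabilityMeasure ν]
    (K : ℕ) (hK : 0 < K)
    (hsparse : ∀ᵐ p ∂ν, (Finset.univ.filter fun y => 0 < p.1 y).card ≤ K)
    (hO : ∀ᵐ p ∂ν, ∀ y ∈ O, 0 < p.1 y)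
    (hreg : ∀ y ∈ (Oᶜ : Finset Ω), ∀ y' ∈ (Oᶜ : Finset Ω),
      ν {p | 0 < p.1 y} = ν {p | 0 < p.1 y'})
    (part : {p : Ω → ℝ // (∀ y, 0 ≤ p y) ∧ ∑ y, p y = 1} → Ω → Finset Ω)
    (hmem : ∀ p y, y ∈ part p y)
    (hcell : ∀ p y z, z ∈ part p y → part p z = part p y)
    (hmeas : Measurable part)
    (g : Ω → ℝ) (hg0 : ∀ y, 0 ≤ g y) (hg1 : ∑ y, g y = 1) :
    (1 : ℝ) - (K : ℝ) / (Oᶜ : Finset Ω).card ≤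
      (ν {p | (∑ y ∈ Oᶜ, p.1 y) / ((K : ℝ) + 1) ^ 2
          - tvDist g (fun y => (∑ z ∈ part p y, p.1 z) / (part p y).card)
            / ((K : ℝ) + 1)
        ≤ ∑ y ∈ (Finset.univ.filter fun y => 0 < p.1 y)ᶜ, g y}).toReal := by
  obtain ⟨s, hs, hmax⟩ := Finset.exists_max_image (Oᶜ : Finset Ω) g hU
  have hmA : ∀ y, MeasurableSet {p : {p : Ω → ℝ // (∀ y, 0 ≤ p y) ∧ ∑ y, p y = 1} | 0 < p.1 y} :=
    fun y => measurableSet_lt measurable_const ((measurable_pi_apply y).comp measurable_subtype_coe)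
  have hsum : ∑ y ∈ (Oᶜ : Finset Ω), ν {p | 0 < p.1 y} ≤ K := by
    calc ∑ y ∈ (Oᶜ : Finset Ω), ν {p | 0 < p.1 y}
        = ∑ y ∈ (Oᶜ : Finset Ω), ∫⁻ p, Set.indicator {p | 0 < p.1 y} 1 p ∂ν :=
          Finset.sum_congr rfl fun y _ => (lintegral_indicator_one (hmA y)).symm
      _ = ∫⁻ p, ∑ y ∈ (Oᶜ : Finset Ω), Set.indicator {p | 0 < p.1 y} 1 p ∂ν :=
          (lintegral_finsetSum _ fun y _ => measurable_one.indicator (hmA y)).symm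
      _ ≤ ∫⁻ _, (K : ENNReal) ∂ν := by
          apply lintegral_mono_ae
          filter_upwards [hsparse] with p hp
          simp only [Set.indicator_apply, Set.mem_ofPred_eq, Pi.one_apply]
          rw [← Finset.sum_filter, Finset.sum_const, nsmul_one]
          exact_mod_cast (Finset.card_le_card
            (Finset.filter_subset_filter _ (Finset.subset_univ _))).trans hp
      _ = K := by simp
  rw [Finset.sum_congr rfl fun y hy => hreg y hy s hs, Finset.sum_const, nsmul_eq_mul] at hsum
  have hq : ((Oᶜ : Finset Ω).card : ℝ) * ν.real {p | 0 < p.1 s} ≤ K := by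
    have := ENNReal.toReal_mono (by simp) hsum
    simpa [Measure.real] using this
  have hc : (0 : ℝ) < (Oᶜ : Finset Ω).card := by exact_mod_cast Finset.card_pos.2 hU
  have hq' : ν.real {p | 0 < p.1 s} ≤ K / (Oᶜ : Finset Ω).card := by
    rw [le_div_iff₀ hc]; linarith
  have hcompl := probReal_compl_eq_one_sub (μ := ν) (hmA s)
  refine le_trans (b := ν.real {p | 0 < p.1 s}ᶜ) (by rw [hcompl]; linarith) ?_
  apply ENNReal.toReal_mono (measure_ne_top _ _)
  apply measure_mono_ae
  filter_upwards [hsparse, hO] with p hp1 hp2 hp3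
  exact aux_det O K p.1 p.2.1 (part p) (hmem p) (hcell p) hp1 hp2 g hg0 s hmax hp3
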